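/- arXiv:math/0309294 — 3 statements merged into one kernel-verified Lean document; each statement's English description precedes it below -/
import Mathlib

section
/- Let A be a C*-algebra, X a Hilbert A-module, and I a closed ideal of A. The quotient map [·]_I : L(X) → L(X_I) satisfies [θ_{ξ,η}]_I = θ_{[ξ]_I,[η]_I} for all ξ, η ∈ X, its restriction to K(X) is a surjection onto K(X_I), and the kernel of this restriction is K(XI). -/
noncomputable section

/-- A (right) Hilbert C*-module over a C*-algebra `A`. -/
class HilbertModule (A : Type*) [CStarAlgebra A] (X : Type*)
    [NormedAddCommGroup X] [NormedSpace ℂ X] : Type _ where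
  rsmul : X → A → X
  inner : X → X → A
  rsmul_add_left : ∀ (x y : X) (a : A), rsmul (x + y) a = rsmul x a + rsmul y a
  rsmul_add_right : ∀ (x : X) (a b : A), rsmul x (a + b) = rsmul x a + rsmul x b
  rsmul_rsmul : ∀ (x : X) (a b : A), rsmul (rsmul x a) b = rsmul x (a * b)
  rsmul_csmul_left : ∀ (c : ℂ) (x : X) (a : A), rsmul (c • x) a = c • rsmul x a
  rsmul_csmul_right : ∀ (c : ℂ) (x : X) (a : A), rsmul x (c • a) = c • rsmul x a
  inner_add_left : ∀ (x y z : X), inner (x + y) z = inner x z + inner y z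
  inner_add_right : ∀ (x y z : X), inner x (y + z) = inner x y + inner x z
  inner_csmul_right : ∀ (c : ℂ) (x y : X), inner x (c • y) = c • inner x y
  star_inner : ∀ (x y : X), star (inner x y) = inner y x
  inner_rsmul_right : ∀ (x y : X) (a : A), inner x (rsmul y a) = inner x y * a
  inner_self_isPositive : ∀ x : X, ∃ b : A, inner x x = star b * b
  norm_sq_inner : ∀ x : X, ‖x‖ ^ 2 = ‖inner x x‖
  norm_inner_le : ∀ x y : X, ‖inner x y‖ ≤ ‖x‖ * ‖y‖
  norm_rsmul_le : ∀ (x : X) (a : A), ‖rsmul x a‖ ≤ ‖x‖ * ‖a‖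

namespace HilbertModule

variable {A : Type*} [CStarAlgebra A] {X : Type*}
  [NormedAddCommGroup X] [NormedSpace ℂ X] [HilbertModule A X]

/-- The closed submodule `X·S` generated by products `ξ·a`, `a ∈ S`. -/
def idealSub (X : Type*) {A : Type*} [CStarAlgebra A] [NormedAddCommGroup X]
    [NormedSpace ℂ X] [HilbertModule A X] (S : Set A) : Set X :=
  closure (Submodule.span ℂ {x : X | ∃ (ξ : X) (a : A), a ∈ S ∧ x = rsmul ξ a} : Set X)

/-- The rank-one ("theta") operator `ζ ↦ ξ⟨η,ζ⟩`. -/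
def rankOne (A : Type*) {X : Type*} [CStarAlgebra A] [NormedAddCommGroup X]
    [NormedSpace ℂ X] [HilbertModule A X] (ξ η : X) : X →L[ℂ] X :=
  LinearMap.mkContinuous
    { toFun := fun ζ => rsmul ξ (inner (A := A) η ζ)
      map_add' := fun x y => by
        show rsmul ξ (inner (A := A) η (x + y)) = _
        rw [inner_add_right, rsmul_add_right]
      map_smul' := fun c x => by
        show rsmul ξ (inner (A := A) η (c • x)) = _
        simp only [RingHom.id_apply]
        rw [inner_csmul_right, rsmul_csmul_right] }
    (‖ξ‖ * ‖η‖)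
    (fun ζ => by
      calc ‖rsmul ξ (inner (A := A) η ζ)‖ ≤ ‖ξ‖ * ‖inner (A := A) η ζ‖ :=
            norm_rsmul_le _ _
        _ ≤ ‖ξ‖ * (‖η‖ * ‖ζ‖) :=
            mul_le_mul_of_nonneg_left (norm_inner_le _ _) (norm_nonneg _)
        _ = ‖ξ‖ * ‖η‖ * ‖ζ‖ := (mul_assoc _ _ _).symm)

/-- The set of "compact" operators `K(X)`: the closed linear span of rank-one operators. -/
def compacts (A X : Type*) [CStarAlgebra A] [NormedAddCommGroup X]
    [NormedSpace ℂ X] [HilbertModule A X] : Set (X →L[ℂ] X) :=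
  closure (Submodule.span ℂ {T : X →L[ℂ] X | ∃ ξ η : X, T = rankOne A ξ η} : Set (X →L[ℂ] X))

/-- `K(X·I)`, viewed inside the operators on `X`: the closed span of rank-one operators
with both legs in the subset `S`. -/
def compactsOn (A : Type*) {X : Type*} [CStarAlgebra A] [NormedAddCommGroup X]
    [NormedSpace ℂ X] [HilbertModule A X] (S : Set X) : Set (X →L[ℂ] X) :=
  closure (Submodule.span ℂ
    {T : X →L[ℂ] X | ∃ ξ ∈ S, ∃ η ∈ S, T = rankOne A ξ η} : Set (X →L[ℂ] X))

/-- An operator is adjointable if it has an adjoint with respect to the `A`-valued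
inner product. -/
def IsAdjointable (A : Type*) {X : Type*} [CStarAlgebra A] [NormedAddCommGroup X]
    [NormedSpace ℂ X] [HilbertModule A X] (S : X →L[ℂ] X) : Prop :=
  ∃ T : X →L[ℂ] X, ∀ x y : X, inner (A := A) (S x) y = inner (A := A) x (T y)

end HilbertModule

/-- A C*-correspondence over `A`: a Hilbert `A`-module with a left action of `A`
by adjointable operators. -/
class Correspondence (A : Type*) [CStarAlgebra A] (X : Type*)
    [NormedAddCommGroup X] [NormedSpace ℂ X] extends HilbertModule A X where
  lsmul : A → X → X
  lsmul_add_left : ∀ (a b : A) (x : X), lsmul (a + b) x = lsmul a x + lsmul b x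
  lsmul_add_right : ∀ (a : A) (x y : X), lsmul a (x + y) = lsmul a x + lsmul a y
  lsmul_mul : ∀ (a b : A) (x : X), lsmul (a * b) x = lsmul a (lsmul b x)
  lsmul_csmul_left : ∀ (c : ℂ) (a : A) (x : X), lsmul (c • a) x = c • lsmul a x
  lsmul_csmul_right : ∀ (c : ℂ) (a : A) (x : X), lsmul a (c • x) = c • lsmul a x
  inner_lsmul_left : ∀ (a : A) (x y : X), inner (lsmul a x) y = inner x (lsmul (star a) y)
  lsmul_rsmul : ∀ (a : A) (x : X) (b : A), lsmul a (rsmul x b) = rsmul (lsmul a x) b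
  norm_lsmul_le : ∀ (a : A) (x : X), ‖lsmul a x‖ ≤ ‖a‖ * ‖x‖

namespace Correspondence

open HilbertModule

variable {A : Type*} [CStarAlgebra A] {X : Type*}
  [NormedAddCommGroup X] [NormedSpace ℂ X] [Correspondence A X]

/-- The left action `φ_X(a)` as a continuous linear operator on `X`. -/
def lact (A : Type*) {X : Type*} [CStarAlgebra A] [NormedAddCommGroup X]
    [NormedSpace ℂ X] [Correspondence A X] (a : A) : X →L[ℂ] X :=
  LinearMap.mkContinuous
    { toFun := lsmul a
      map_add' := lsmul_add_right a
      map_smul' := fun c x => by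
        show lsmul a (c • x) = _
        simp only [RingHom.id_apply]; rw [lsmul_csmul_right] }
    ‖a‖ (norm_lsmul_le a)

/-- The ideal `X(S)`: closed span of `{⟨η, φ_X(a)ξ⟩ : a ∈ S}`. -/
def corrApply (X : Type*) {A : Type*} [CStarAlgebra A] [NormedAddCommGroup X]
    [NormedSpace ℂ X] [Correspondence A X] (S : Set A) : Set A :=
  closure (Submodule.span ℂ
    {b : A | ∃ a ∈ S, ∃ ξ η : X, b = inner (A := A) η (lsmul a ξ)} : Set A)

/-- The ideal `X⁻¹(S) = {a : ⟨η, φ_X(a)ξ⟩ ∈ S for all ξ, η}`. -/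
def corrInv (X : Type*) {A : Type*} [CStarAlgebra A] [NormedAddCommGroup X]
    [NormedSpace ℂ X] [Correspondence A X] (S : Set A) : Set A :=
  {a : A | ∀ ξ η : X, inner (A := A) η (lsmul a ξ) ∈ S}

/-- The kernel of the left action `φ_X`. -/
def kerLact (X : Type*) {A : Type*} [CStarAlgebra A] [NormedAddCommGroup X]
    [NormedSpace ℂ X] [Correspondence A X] : Set A :=
  {a : A | ∀ ξ : X, lsmul a ξ = 0}

/-- Katsura's ideal `J_X = φ_X⁻¹(K(X)) ∩ (ker φ_X)^⊥`. -/
def JX (X : Type*) {A : Type*} [CStarAlgebra A] [NormedAddCommGroup X]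
    [NormedSpace ℂ X] [Correspondence A X] : Set A :=
  {a : A | lact A (X := X) a ∈ compacts A X ∧ ∀ b ∈ kerLact X, a * b = 0}

end Correspondence

open HilbertModule Correspondence

/-- Data presenting a Hilbert `B`-module `Y` as the quotient `X_I = X/XI` of a Hilbert
`A`-module `X` by a closed two-sided ideal `I` of `A` (with `B` playing the role of `A/I`). -/
structure QuotientData (A B : Type*) [CStarAlgebra A] [CStarAlgebra B]
    (I : TwoSidedIdeal A)
    (X Y : Type*) [NormedAddCommGroup X] [NormedSpace ℂ X] [HilbertModule A X]
    [NormedAddCommGroup Y] [NormedSpace ℂ Y] [HilbertModule B Y] : Type _ where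
  π : A →⋆ₐ[ℂ] B
  π_surjective : Function.Surjective π
  π_ker : ∀ a : A, π a = 0 ↔ a ∈ I
  q : X →ₗ[ℂ] Y
  q_surjective : Function.Surjective q
  q_ker : ∀ ξ : X, q ξ = 0 ↔ ξ ∈ idealSub X (I : Set A)
  q_inner : ∀ ξ ζ : X, inner (A := B) (q ξ) (q ζ) = π (inner (A := A) ξ ζ)
  q_rsmul : ∀ (ξ : X) (a : A), q (rsmul ξ a) = rsmul (q ξ) (π a)


/-- Quotient data compatible with the left actions (presenting `X_I` as a
C*-correspondence over `A/I`). -/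
structure CorrQuotientData (A B : Type*) [CStarAlgebra A] [CStarAlgebra B]
    (I : TwoSidedIdeal A)
    (X Y : Type*) [NormedAddCommGroup X] [NormedSpace ℂ X] [Correspondence A X]
    [NormedAddCommGroup Y] [NormedSpace ℂ Y] [Correspondence B Y]
    extends QuotientData A B I X Y where
  q_lsmul : ∀ (a : A) (ξ : X), q (lsmul a ξ) = lsmul (π a) (q ξ)

/-- Katsura's ideal `J(I) = {a : [φ_X(a)]_I ∈ K(X_I), a·X⁻¹(I) ⊂ I}`, expressed via
quotient data presenting `X_I`. -/
def JofI {A B : Type*} [CStarAlgebra A] [CStarAlgebra B] {I : TwoSidedIdeal A}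
    {X Y : Type*} [NormedAddCommGroup X] [NormedSpace ℂ X] [Correspondence A X]
    [NormedAddCommGroup Y] [NormedSpace ℂ Y] [HilbertModule B Y]
    (D : QuotientData A B I X Y) : Set A :=
  {a : A | (∃ T ∈ compacts B Y, ∀ ξ : X, T (D.q ξ) = D.q (lsmul a ξ)) ∧
    ∀ b ∈ corrInv X (I : Set A), a * b ∈ I}

/-- A Hilbert `A`-bimodule: a C*-correspondence together with a left inner product
satisfying `φ_X(⟪ξ,η⟫) = θ_{ξ,η}`. -/
class HilbertBimodule (A : Type*) [CStarAlgebra A] (X : Type*)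
    [NormedAddCommGroup X] [NormedSpace ℂ X] extends Correspondence A X where
  linner : X → X → A
  lsmul_linner : ∀ ξ η ζ : X, lsmul (linner ξ η) ζ = rsmul ξ (inner η ζ)

/-- The closed subspace `φ_X(S)X`: closed span of `{φ_X(a)ξ : a ∈ S}`. -/
def lsmulSet (X : Type*) {A : Type*} [CStarAlgebra A] [NormedAddCommGroup X]
    [NormedSpace ℂ X] [Correspondence A X] (S : Set A) : Set X :=
  closure (Submodule.span ℂ
    {x : X | ∃ a ∈ S, ∃ ξ : X, x = Correspondence.lsmul a ξ} : Set X)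

namespace QuotCompacts

section Cstar
variable {L M : Type*} [CStarAlgebra L] [CStarAlgebra M]

lemma norm_mul_cfc_le (a : L) (g : ℝ → ℝ) (hg : Continuous g) (c : ℝ) (hc : 0 ≤ c)
    (h : ∀ t : ℝ, 0 ≤ t → t * g t ^ 2 ≤ c ^ 2) :
    ‖a * cfc g (star a * a)‖ ≤ c := by
  have hsa : IsSelfAdjoint (star a * a) := IsSelfAdjoint.star_mul_self a
  have hgs : star (cfc g (star a * a)) = cfc g (star a * a) := by
    rw [← cfc_star]; simp
  have key : star (a * cfc g (star a * a)) * (a * cfc g (star a * a)) =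
      cfc (fun t => g t * (t * g t)) (star a * a) := by
    rw [star_mul, hgs, cfc_mul g (fun t => t * g t) (star a * a) (by fun_prop) (by fun_prop),
      cfc_mul (fun t => t) g (star a * a) (by fun_prop) (by fun_prop), cfc_id' ℝ (star a * a)]
    simp only [mul_assoc]
  have h2 : ‖a * cfc g (star a * a)‖ ^ 2 ≤ c ^ 2 := by
    rw [pow_two, ← CStarRing.norm_star_mul_self, key]
    refine norm_cfc_le (by positivity) fun t ht => ?_
    have ht0 : 0 ≤ t := spectrum_star_mul_self_nonneg t ht
    rw [Real.norm_eq_abs, abs_of_nonneg]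
    · have := h t ht0; nlinarith
    · have : g t * (t * g t) = t * g t ^ 2 := by ring
      rw [this]; positivity
  exact (pow_le_pow_iff_left₀ (norm_nonneg _) hc two_ne_zero).1 h2

/-- Norm-controlled correction of a lift. -/
lemma exists_lift (Φ : L →⋆ₐ[ℂ] M) (a : L) (c : ℝ) (hc : 0 < c) (h : ‖Φ a‖ ≤ c) :
    ∃ r : L, ‖a * r‖ ≤ c ∧ Φ (a * r) = Φ a := by
  let f : ℝ → ℝ := fun t => (Real.sqrt (max 1 (t / c ^ 2)))⁻¹
  have hpos : ∀ t : ℝ, 0 < max 1 (t / c ^ 2) := fun t => lt_max_of_lt_left one_pos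
  have hf : Continuous f := by
    refine Continuous.inv₀ (by fun_prop) fun t => ?_
    exact (Real.sqrt_pos.2 (hpos t)).ne'
  refine ⟨cfc f (star a * a), norm_mul_cfc_le a f hf c hc.le ?_, ?_⟩
  · intro t ht
    simp only [f]
    rw [inv_pow, Real.sq_sqrt (hpos t).le, ← div_eq_mul_inv, div_le_iff₀ (hpos t)]
    have := le_max_right 1 (t / c ^ 2)
    rw [div_le_iff₀ (by positivity)] at this
    linarith
  · have hsa : IsSelfAdjoint (star a * a) := IsSelfAdjoint.star_mul_self a
    have hsb : IsSelfAdjoint (Φ (star a * a)) := hsa.map Φ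
    have hΦ : Continuous Φ := by
      refine AddMonoidHomClass.continuous_of_bound Φ 1 fun x => ?_
      simpa using NonUnitalStarAlgHom.norm_apply_le Φ x
    have hmap : Φ (cfc f (star a * a)) = cfc f (Φ (star a * a)) :=
      StarAlgHomClass.map_cfc (S := ℂ) Φ f (star a * a) hf.continuousOn hΦ hsa hsb
    have hone : cfc f (Φ (star a * a)) = 1 := by
      rw [← cfc_one ℝ (Φ (star a * a)) hsb]
      refine cfc_congr fun t ht => ?_
      have h1 : ‖t‖ ≤ ‖Φ (star a * a)‖ * ‖(1 : M)‖ := spectrum.norm_le_norm_mul_of_mem ht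
      have hM : ‖(1 : M)‖ ≤ 1 := by
        rcases subsingleton_or_nontrivial M with hs | hs
        · simp [Subsingleton.elim (1 : M) 0]
        · simp
      have h2 : ‖Φ (star a * a)‖ ≤ c ^ 2 := by
        rw [map_mul, map_star, CStarRing.norm_star_mul_self, pow_two]
        exact mul_self_le_mul_self (norm_nonneg _) h
      have h3 : t ≤ c ^ 2 := by
        calc t ≤ ‖t‖ := Real.le_norm_self t
          _ ≤ _ := h1
          _ ≤ ‖Φ (star a * a)‖ * 1 := by gcongr
          _ ≤ c ^ 2 := by simpa using h2
      have h4 : t / c ^ 2 ≤ 1 := by rw [div_le_one (by positivity)]; exact h3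
      simp [f, max_eq_left h4]
    rw [map_mul, hmap, hone, mul_one]

/-- `a` is a limit of `a * a⋆ * (a * r)`. -/
lemma exists_approx (a : L) (ε : ℝ) (hε : 0 < ε) :
    ∃ r : L, ‖a - a * star a * (a * r)‖ ≤ ε := by
  let h : ℝ → ℝ := fun t => (|t| + ε ^ 2)⁻¹
  have hpos : ∀ t : ℝ, 0 < |t| + ε ^ 2 := fun t => by positivity
  have hh : Continuous h := Continuous.inv₀ (by fun_prop) fun t => (hpos t).ne'
  have hsa : IsSelfAdjoint (star a * a) := IsSelfAdjoint.star_mul_self a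
  refine ⟨cfc h (star a * a), ?_⟩
  have e : a - a * star a * (a * cfc h (star a * a)) =
      a * cfc (fun t => 1 - t * h t) (star a * a) := by
    rw [cfc_sub (fun _ => (1:ℝ)) (fun t => t * h t) (star a * a) (by fun_prop) (by fun_prop),
      cfc_mul (fun t => t) h (star a * a) (by fun_prop) (by fun_prop), cfc_id' ℝ (star a * a),
      cfc_const_one ℝ (star a * a)]
    simp only [mul_sub, mul_one, mul_assoc]
  rw [e]
  refine norm_mul_cfc_le a _ (by fun_prop) ε hε.le fun t ht => ?_
  have hp := hpos t
  have : 1 - t * h t = ε ^ 2 / (t + ε ^ 2) := by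
    simp only [h]; rw [abs_of_nonneg ht] at hp ⊢; field_simp; ring
  rw [this, div_pow, mul_div_assoc', div_le_iff₀ (by positivity)]
  nlinarith [mul_nonneg (sq_nonneg ε) (sq_nonneg t), mul_nonneg (sq_nonneg ε) (sq_nonneg (ε^2)),
    mul_nonneg (mul_nonneg (sq_nonneg ε) (sq_nonneg ε)) ht]

end Cstar
section Adj
open HilbertModule
variable {A : Type*} [CStarAlgebra A] {X : Type*}
  [NormedAddCommGroup X] [NormedSpace ℂ X] [HilbertModule A X]

lemma inner_csmul_left (c : ℂ) (x y : X) : (HilbertModule.inner (A := A) (c • x) y) = star c • (HilbertModule.inner (A := A) x y) := by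
  rw [← star_inner, inner_csmul_right, star_smul, star_inner]

lemma inner_rsmul_left (x y : X) (a : A) : (HilbertModule.inner (A := A) (rsmul x a) y) = star a * (HilbertModule.inner (A := A) x y) := by
  rw [← star_inner, inner_rsmul_right, star_mul, star_inner]

lemma inner_sub_right (x y z : X) : (HilbertModule.inner (A := A) x (y - z)) = (HilbertModule.inner (A := A) x y) - (HilbertModule.inner (A := A) x z) := by
  have h := HilbertModule.inner_add_right (A := A) x (y - z) z
  rw [sub_add_cancel] at h
  rw [h, add_sub_cancel_right]

lemma inner_sub_left (x y z : X) : (HilbertModule.inner (A := A) (x - y) z) = (HilbertModule.inner (A := A) x z) - (HilbertModule.inner (A := A) y z) := by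
  have h := HilbertModule.inner_add_left (A := A) (x - y) y z
  rw [sub_add_cancel] at h
  rw [h, add_sub_cancel_right]

variable (A) in
lemma ext_inner_left {y z : X} (h : ∀ x, (HilbertModule.inner (A := A) x y) = (HilbertModule.inner (A := A) x z)) : y = z := by
  rw [← sub_eq_zero, ← norm_eq_zero]
  have : ‖y - z‖ ^ 2 = 0 := by
    rw [norm_sq_inner (A := A), inner_sub_right, h, sub_self, norm_zero]
  exact pow_eq_zero_iff two_ne_zero |>.1 this

lemma continuous_inner (x : X) : Continuous fun y => (HilbertModule.inner (A := A) x y) := by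
  refine (LipschitzWith.of_dist_le_mul (K := ‖x‖₊) fun y z => ?_).continuous
  rw [dist_eq_norm, dist_eq_norm, ← inner_sub_right]
  exact norm_inner_le x (y - z)

lemma continuous_inner_left (y : X) : Continuous fun x => (HilbertModule.inner (A := A) x y) := by
  have : (fun x => (HilbertModule.inner (A := A) x y)) = fun x => star (HilbertModule.inner (A := A) y x) := by
    ext x; rw [star_inner]
  rw [this]
  exact (continuous_inner y).star

variable (A X) in
/-- The algebra of adjointable operators. -/
def adj : Subalgebra ℂ (X →L[ℂ] X) where
  carrier := {T | IsAdjointable A T}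
  mul_mem' := by
    rintro S T ⟨S', hS⟩ ⟨T', hT⟩
    exact ⟨T' * S', fun x y => by
      simp only [mul_apply_eq_comp]; rw [hS, hT]⟩
  add_mem' := by
    rintro S T ⟨S', hS⟩ ⟨T', hT⟩
    exact ⟨S' + T', fun x y => by
      simp only [add_apply]
      rw [HilbertModule.inner_add_left, HilbertModule.inner_add_right, hS, hT]⟩
  algebraMap_mem' c := ⟨algebraMap ℂ _ (star c), fun x y => by
    simp only [ContinuousLinearMap.algebraMap_apply]
    rw [inner_csmul_left, inner_csmul_right]⟩

instance instNR : NormedRing (adj A X) := Subalgebra.normedRing _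

instance instNUNR : NonUnitalNormedRing (adj A X) := NormedRing.toNonUnitalNormedRing

instance instNorm : Norm (adj A X) := NormedRing.toNorm

/-- The adjoint. -/
def adjoint (T : adj A X) : X →L[ℂ] X := Classical.choose T.2

lemma inner_apply_left (T : adj A X) (x y : X) :
    (HilbertModule.inner (A := A) ((T : X →L[ℂ] X) x) y) = (HilbertModule.inner (A := A) x (adjoint T y)) := Classical.choose_spec T.2 x y

lemma inner_apply_right (T : adj A X) (x y : X) :
    (HilbertModule.inner (A := A) x ((T : X →L[ℂ] X) y)) = (HilbertModule.inner (A := A) (adjoint T x) y) := by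
  rw [← star_inner, inner_apply_left, star_inner]

instance : Star (adj A X) where
  star T := ⟨adjoint T, T, fun x y => (inner_apply_right T x y).symm⟩

lemma inner_star_right (T : adj A X) (x y : X) :
    (HilbertModule.inner (A := A) x ((star T : adj A X).1 y)) = (HilbertModule.inner (A := A) (T.1 x) y) := (inner_apply_left T x y).symm

lemma inner_star_left (T : adj A X) (x y : X) :
    (HilbertModule.inner (A := A) ((star T : adj A X).1 x) y) = (HilbertModule.inner (A := A) x (T.1 y)) := (inner_apply_right T x y).symm

lemma adj_ext {S T : adj A X} (h : ∀ x y, (HilbertModule.inner (A := A) x (S.1 y)) = (HilbertModule.inner (A := A) x (T.1 y))) : S = T :=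
  Subtype.ext <| ContinuousLinearMap.ext fun y => ext_inner_left A fun x => h x y

instance : StarRing (adj A X) where
  star_involutive T := adj_ext fun x y => by rw [inner_star_right, inner_star_left]
  star_mul S T := adj_ext fun x y => by
    rw [inner_star_right]
    change (HilbertModule.inner (A := A) (S.1 (T.1 x)) y) = (HilbertModule.inner (A := A) x ((star T : adj A X).1 ((star S : adj A X).1 y)))
    rw [inner_star_right, inner_star_right]
  star_add S T := adj_ext fun x y => by
    rw [inner_star_right]
    change (HilbertModule.inner (A := A) (S.1 x + T.1 x) y) = (HilbertModule.inner (A := A) x ((star S : adj A X).1 y + (star T : adj A X).1 y))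
    rw [HilbertModule.inner_add_left, HilbertModule.inner_add_right, inner_star_right,
      inner_star_right]

instance : StarModule ℂ (adj A X) where
  star_smul c T := adj_ext fun x y => by
    rw [inner_star_right]
    change (HilbertModule.inner (A := A) (c • T.1 x) y) = (HilbertModule.inner (A := A) x (star c • (star T : adj A X).1 y))
    rw [inner_csmul_left, inner_csmul_right, inner_star_right]

instance : CStarRing (adj A X) where
  norm_mul_self_le T := by
    have hb : ‖T.1‖ ≤ Real.sqrt ‖star T * T‖ := by
      refine ContinuousLinearMap.opNorm_le_bound _ (Real.sqrt_nonneg _) fun x => ?_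
      have h : ‖T.1 x‖ ^ 2 ≤ (Real.sqrt ‖star T * T‖ * ‖x‖) ^ 2 := by
        rw [norm_sq_inner (A := A), ← inner_star_right, mul_pow, Real.sq_sqrt (norm_nonneg (star T * T))]
        refine (norm_inner_le _ _).trans ?_
        have : ‖(star T : adj A X).1 (T.1 x)‖ ≤ ‖star T * T‖ * ‖x‖ :=
          (star T * T : adj A X).1.le_opNorm x
        nlinarith [norm_nonneg x]
      exact (pow_le_pow_iff_left₀ (norm_nonneg _) (by positivity) two_ne_zero).1 h
    calc ‖T‖ * ‖T‖ ≤ Real.sqrt ‖star T * T‖ * Real.sqrt ‖star T * T‖ :=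
          mul_self_le_mul_self (norm_nonneg _) hb
      _ = _ := Real.mul_self_sqrt (norm_nonneg _)

variable [CompleteSpace X]

lemma isClosed_adj : IsClosed (adj A X : Set (X →L[ℂ] X)) := by
  refine isClosed_of_closure_subset fun T hT => ?_
  obtain ⟨u, hu, hlim⟩ := mem_closure_iff_seq_limit.1 hT
  let v : ℕ → adj A X := fun n => ⟨u n, hu n⟩
  have hv : CauchySeq v := by
    have := hlim.cauchySeq
    rw [Metric.cauchySeq_iff] at this ⊢
    exact this
  have hsv : CauchySeq fun n => (star (v n) : adj A X).1 := by
    rw [Metric.cauchySeq_iff] at hv ⊢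
    intro ε hε
    obtain ⟨N, hN⟩ := hv ε hε
    refine ⟨N, fun m hm n hn => ?_⟩
    have := hN m hm n hn
    rw [dist_eq_norm, ← norm_star, star_sub] at this
    rw [dist_eq_norm]
    exact this
  obtain ⟨T', hT'⟩ := cauchySeq_tendsto_of_complete hsv
  refine ⟨T', fun x y => ?_⟩
  have h1 : Filter.Tendsto (fun n => (HilbertModule.inner (A := A) (u n x) y)) Filter.atTop (nhds (HilbertModule.inner (A := A) (T x) y)) :=
    ((continuous_inner_left y).tendsto _).comp
      (((ContinuousLinearMap.apply ℂ X x).continuous.tendsto T).comp hlim)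
  have h2 : Filter.Tendsto (fun n => (HilbertModule.inner (A := A) x ((star (v n) : adj A X).1 y))) Filter.atTop
      (nhds (HilbertModule.inner (A := A) x (T' y))) :=
    ((continuous_inner x).tendsto _).comp
      (((ContinuousLinearMap.apply ℂ X y).continuous.tendsto T').comp hT')
  refine tendsto_nhds_unique h1 (h2.congr fun n => ?_)
  rw [inner_star_right]

instance : CompleteSpace (adj A X) := isClosed_adj.completeSpace_coe

instance : CStarAlgebra (adj A X) where

end Adj
section Compacts
open HilbertModule
variable {A : Type*} [CStarAlgebra A] {X : Type*}
  [NormedAddCommGroup X] [NormedSpace ℂ X] [HilbertModule A X]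

lemma rankOne_apply (ξ η ζ : X) : rankOne A ξ η ζ = rsmul ξ (HilbertModule.inner (A := A) η ζ) := rfl

/-- Rank-one operators as elements of the algebra of adjointable operators. -/
def θ (ξ η : X) : adj A X := ⟨rankOne A ξ η, rankOne A η ξ, fun x y => by
  rw [rankOne_apply, rankOne_apply, inner_rsmul_left, inner_rsmul_right, star_inner]⟩

lemma star_θ (ξ η : X) : star (θ ξ η : adj A X) = θ η ξ := adj_ext fun x y => by
  rw [inner_star_right]
  change (HilbertModule.inner (A := A) (rankOne A ξ η x) y) = (HilbertModule.inner (A := A) x (rankOne A η ξ y))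
  rw [rankOne_apply, rankOne_apply, inner_rsmul_left, inner_rsmul_right, star_inner]

lemma apply_rsmul (T : adj A X) (x : X) (a : A) : T.1 (rsmul x a) = rsmul (T.1 x) a :=
  ext_inner_left A fun y => by
    rw [← inner_star_left, inner_rsmul_right, inner_rsmul_right, inner_star_left]

lemma mul_θ (T : adj A X) (ξ η : X) : T * θ ξ η = θ (T.1 ξ) η := adj_ext fun x y => by
  change (HilbertModule.inner (A := A) x (T.1 (rankOne A ξ η y))) = (HilbertModule.inner (A := A) x (rankOne A (T.1 ξ) η y))
  rw [rankOne_apply, rankOne_apply, apply_rsmul]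

lemma θ_mul (T : adj A X) (ξ η : X) : θ ξ η * T = θ ξ ((star T : adj A X).1 η) :=
  adj_ext fun x y => by
    change (HilbertModule.inner (A := A) x (rankOne A ξ η (T.1 y))) = (HilbertModule.inner (A := A) x (rankOne A ξ ((star T : adj A X).1 η) y))
    rw [rankOne_apply, rankOne_apply, inner_star_left]

variable (A X) in
/-- Finite rank operators. -/
def fin : Submodule ℂ (adj A X) := Submodule.span ℂ {T | ∃ ξ η : X, T = θ ξ η}

lemma fin_mul {S : adj A X} (hS : S ∈ fin A X) (T : adj A X) : S * T ∈ fin A X := by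
  induction hS using Submodule.span_induction with
  | mem x h =>
    obtain ⟨ξ, η, rfl⟩ := h
    rw [θ_mul]
    exact Submodule.subset_span ⟨_, _, rfl⟩
  | zero => rw [zero_mul]; exact zero_mem _
  | add x y _ _ hx hy => rw [add_mul]; exact add_mem hx hy
  | smul c x _ hx => rw [smul_mul_assoc]; exact Submodule.smul_mem _ _ hx

lemma fin_star {S : adj A X} (hS : S ∈ fin A X) : star S ∈ fin A X := by
  induction hS using Submodule.span_induction with
  | mem x h =>
    obtain ⟨ξ, η, rfl⟩ := h
    rw [star_θ]
    exact Submodule.subset_span ⟨_, _, rfl⟩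
  | zero => rw [star_zero]; exact zero_mem _
  | add x y _ _ hx hy => rw [star_add]; exact add_mem hx hy
  | smul c x _ hx => rw [star_smul]; exact Submodule.smul_mem _ _ hx

lemma coe_fin : ((fin A X).map (adj A X).val.toLinearMap) =
    Submodule.span ℂ {T : X →L[ℂ] X | ∃ ξ η : X, T = rankOne A ξ η} := by
  rw [fin, Submodule.map_span]
  congr 1
  ext T
  constructor
  · rintro ⟨_, ⟨ξ, η, rfl⟩, rfl⟩; exact ⟨ξ, η, rfl⟩
  · rintro ⟨ξ, η, rfl⟩; exact ⟨_, ⟨ξ, η, rfl⟩, rfl⟩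

lemma compacts_eq [CompleteSpace X] :
    compacts A X = Set.image (Subtype.val : adj A X → X →L[ℂ] X)
      (closure (fin A X : Set (adj A X))) := by
  have hc : Topology.IsClosedEmbedding (Subtype.val : adj A X → X →L[ℂ] X) :=
    isClosed_adj.isClosedEmbedding_subtypeVal
  rw [← hc.isClosedMap.closure_image_eq_of_continuous hc.continuous, compacts, ← coe_fin]
  rfl

lemma cfin_mul [CompleteSpace X] {S : adj A X} (hS : S ∈ closure (fin A X : Set (adj A X)))
    (T : adj A X) : S * T ∈ closure (fin A X : Set (adj A X)) :=
  map_mem_closure (f := fun S => S * T) (by fun_prop) hS fun _ h => fin_mul h T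

lemma cfin_star [CompleteSpace X] {S : adj A X} (hS : S ∈ closure (fin A X : Set (adj A X))) :
    star S ∈ closure (fin A X : Set (adj A X)) :=
  map_mem_closure (f := fun S => star S) continuous_star hS fun _ h => fin_star h

/-- The key step for the kernel. -/
lemma mul_mul_mem [CompleteSpace X] (V : Set X) {P Q S : adj A X}
    (hP : ∀ x, P.1 x ∈ V) (hQ : ∀ x, (star Q : adj A X).1 x ∈ V)
    (hS : S ∈ closure (fin A X : Set (adj A X))) : (P * S * Q).1 ∈ compactsOn A V := by
  refine map_mem_closure (f := fun S : adj A X => (P * S * Q).1)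
    (continuous_subtype_val.comp (by fun_prop)) hS fun S h => ?_
  beta_reduce
  induction h using Submodule.span_induction with
  | mem x h =>
    obtain ⟨ξ, η, rfl⟩ := h
    rw [mul_θ, θ_mul]
    exact Submodule.subset_span ⟨_, hP _, _, hQ _, rfl⟩
  | zero => rw [mul_zero, zero_mul]; exact zero_mem _
  | add x y _ _ hx hy => rw [mul_add, add_mul]; exact add_mem hx hy
  | smul c x _ hx => rw [mul_smul_comm, smul_mul_assoc]; exact Submodule.smul_mem _ c hx

end Compacts

section Quot
open HilbertModule
variable {A B : Type*} [CStarAlgebra A] [CStarAlgebra B]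
    {X Y : Type*} [NormedAddCommGroup X] [NormedSpace ℂ X] [HilbertModule A X]
    [NormedAddCommGroup Y] [NormedSpace ℂ Y] [HilbertModule B Y]
    {I : TwoSidedIdeal A}
    (D : QuotientData A B I X Y)

/-- The quotient map as a continuous map. -/
def qL : X →L[ℂ] Y := D.q.mkContinuous 1 fun x => by
  have h : ‖D.q x‖ ^ 2 ≤ ‖x‖ ^ 2 := by
    rw [norm_sq_inner (A := B), norm_sq_inner (A := A), D.q_inner]
    exact NonUnitalStarAlgHom.norm_apply_le D.π _
  rw [one_mul]
  exact (pow_le_pow_iff_left₀ (norm_nonneg _) (norm_nonneg _) two_ne_zero).1 h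

lemma qL_apply (x : X) : qL D x = D.q x := rfl

lemma q_rankOne (ξ η ζ : X) :
    rankOne B (D.q ξ) (D.q η) (D.q ζ) = D.q (rankOne A ξ η ζ) := by
  rw [rankOne_apply, rankOne_apply, D.q_inner, D.q_rsmul]

lemma q_apply_eq_zero (T : adj A X) {x : X} (hx : D.q x = 0) : D.q (T.1 x) = 0 := by
  rw [D.q_ker] at hx ⊢
  refine map_mem_closure (f := T.1) T.1.continuous hx fun x h => ?_
  induction h using Submodule.span_induction with
  | mem x h =>
    obtain ⟨ξ, a, ha, rfl⟩ := h
    rw [apply_rsmul]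
    exact Submodule.subset_span ⟨_, a, ha, rfl⟩
  | zero => rw [map_zero]; exact zero_mem _
  | add x y _ _ hx hy => rw [map_add]; exact add_mem hx hy
  | smul c x _ hx => rw [map_smul]; exact Submodule.smul_mem _ _ hx

variable [CompleteSpace X] [CompleteSpace Y]

lemma exists_quot (T : adj A X) : ∃ T' : Y →L[ℂ] Y, ∀ x, T' (D.q x) = D.q (T.1 x) := by
  obtain ⟨C, hC, hpre⟩ := (qL D).exists_preimage_norm_le D.q_surjective
  choose s hs hsn using hpre
  have hs' : ∀ y, D.q (s y) = y := hs
  have key : ∀ x x', D.q x = D.q x' → D.q (T.1 x) = D.q (T.1 x') := fun x x' h => by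
    rw [← sub_eq_zero, ← map_sub, ← map_sub]
    exact q_apply_eq_zero D T (by rw [map_sub, h, sub_self])
  let f : Y →ₗ[ℂ] Y :=
    { toFun := fun y => D.q (T.1 (s y))
      map_add' := fun y z => by
        rw [← map_add, ← map_add]
        exact key _ _ (by rw [map_add, hs', hs', hs'])
      map_smul' := fun c y => by
        rw [RingHom.id_apply, ← map_smul, ← map_smul]
        exact key _ _ (by rw [map_smul, hs', hs']) }
  refine ⟨f.mkContinuous (‖qL D‖ * (‖T.1‖ * C)) fun y => ?_, fun x => key _ _ (hs' _)⟩
  calc ‖qL D (T.1 (s y))‖ ≤ ‖qL D‖ * ‖T.1 (s y)‖ := (qL D).le_opNorm _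
    _ ≤ ‖qL D‖ * (‖T.1‖ * ‖s y‖) := by gcongr; exact T.1.le_opNorm _
    _ ≤ ‖qL D‖ * (‖T.1‖ * (C * ‖y‖)) := by gcongr; exact hsn y
    _ = _ := by ring

/-- `[T]_I`. -/
def quotFun (T : adj A X) : Y →L[ℂ] Y := Classical.choose (exists_quot D T)

lemma quotFun_apply (T : adj A X) (x : X) : quotFun D T (D.q x) = D.q (T.1 x) :=
  Classical.choose_spec (exists_quot D T) x

lemma inner_quotFun (T : adj A X) (x y : Y) :
    (HilbertModule.inner (A := B) (quotFun D T x) y) = (HilbertModule.inner (A := B) x (quotFun D (star T) y)) := by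
  obtain ⟨x, rfl⟩ := D.q_surjective x
  obtain ⟨y, rfl⟩ := D.q_surjective y
  rw [quotFun_apply, quotFun_apply, D.q_inner, D.q_inner, inner_star_right]

/-- `[T]_I` as an adjointable operator. -/
def quotAdj (T : adj A X) : adj B Y := ⟨quotFun D T, quotFun D (star T), inner_quotFun D T⟩

lemma quotAdj_apply (T : adj A X) (x : X) : (quotAdj D T).1 (D.q x) = D.q (T.1 x) :=
  quotFun_apply D T x

lemma adj_ext_q {S T : adj B Y} (h : ∀ x, S.1 (D.q x) = T.1 (D.q x)) : S = T :=
  Subtype.ext <| ContinuousLinearMap.ext fun y => by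
    obtain ⟨x, rfl⟩ := D.q_surjective y
    exact h x

/-- The quotient homomorphism. -/
def Φ : adj A X →⋆ₐ[ℂ] adj B Y where
  toFun := quotAdj D
  map_one' := adj_ext_q D fun x => by rw [quotAdj_apply]; rfl
  map_mul' S T := adj_ext_q D fun x => by
    change _ = (quotAdj D S).1 ((quotAdj D T).1 (D.q x))
    rw [quotAdj_apply, quotAdj_apply, quotAdj_apply]; rfl
  map_zero' := adj_ext_q D fun x => by
    rw [quotAdj_apply]
    change D.q 0 = 0
    rw [map_zero]
  map_add' S T := adj_ext_q D fun x => by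
    change _ = (quotAdj D S).1 (D.q x) + (quotAdj D T).1 (D.q x)
    rw [quotAdj_apply, quotAdj_apply, quotAdj_apply, ← map_add]; rfl
  commutes' c := adj_ext_q D fun x => by
    rw [quotAdj_apply]
    change D.q (c • x) = c • D.q x
    rw [map_smul]
  map_star' T := adj_ext fun x y => by
    rw [inner_star_right]
    exact (inner_quotFun D T x y).symm

lemma Φ_apply (T : adj A X) (x : X) : (Φ D T).1 (D.q x) = D.q (T.1 x) := quotFun_apply D T x

lemma Φ_θ (ξ η : X) : Φ D (θ ξ η) = θ (D.q ξ) (D.q η) := adj_ext_q D fun x => by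
  rw [Φ_apply]; exact (q_rankOne D ξ η x).symm

lemma exists_fin_lift {S : adj B Y} (hS : S ∈ fin B Y) : ∃ T ∈ fin A X, Φ D T = S := by
  induction hS using Submodule.span_induction with
  | mem x h =>
    obtain ⟨ξ, η, rfl⟩ := h
    obtain ⟨ξ, rfl⟩ := D.q_surjective ξ
    obtain ⟨η, rfl⟩ := D.q_surjective η
    exact ⟨_, Submodule.subset_span ⟨ξ, η, rfl⟩, Φ_θ D ξ η⟩
  | zero => exact ⟨0, zero_mem _, map_zero _⟩
  | add x y _ _ hx hy =>
    obtain ⟨a, ha, rfl⟩ := hx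
    obtain ⟨b, hb, rfl⟩ := hy
    exact ⟨a + b, add_mem ha hb, map_add _ _ _⟩
  | smul c x _ hx =>
    obtain ⟨a, ha, rfl⟩ := hx
    exact ⟨c • a, Submodule.smul_mem _ _ ha, map_smul _ _ _⟩

lemma exists_lift_closure {S : adj B Y} (hS : S ∈ closure (fin B Y : Set (adj B Y))) :
    ∃ T ∈ closure (fin A X : Set (adj A X)), Φ D T = S := by
  let K : Submodule ℂ (adj A X) := (fin A X).topologicalClosure
  have : CompleteSpace K := (fin A X).isClosed_topologicalClosure.completeSpace_coe
  let f : NormedAddGroupHom K (adj B Y) :=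
    AddMonoidHom.mkNormedAddGroupHom ((Φ D : adj A X →+ adj B Y).comp K.toAddSubgroup.subtype) 1
      fun T => by
        rw [one_mul]
        exact NonUnitalStarAlgHom.norm_apply_le (Φ D) T.1
  have hf : f.SurjectiveOnWith (fin B Y).toAddSubgroup 1 := by
    intro S hS
    rcases eq_or_ne S 0 with rfl | h0
    · exact ⟨0, map_zero f, by simp⟩
    obtain ⟨T, hT, rfl⟩ := exists_fin_lift D hS
    obtain ⟨r, hr, hr'⟩ := exists_lift (Φ D) T ‖Φ D T‖ (norm_pos_iff.2 h0) le_rfl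
    exact ⟨⟨T * r, subset_closure (fin_mul hT r)⟩, hr', by rw [one_mul]; exact hr⟩
  obtain ⟨T, hT, -⟩ := controlled_closure_of_complete one_pos one_pos hf S hS
  exact ⟨T.1, T.2, hT⟩

lemma rsmul_mem_ker {ξ : X} (hξ : D.q ξ = 0) (a : A) : D.q (rsmul ξ a) = 0 := by
  have h : rsmul (0 : Y) (D.π a) = 0 := by
    have := rsmul_csmul_left (0 : ℂ) (0 : Y) (D.π a)
    simpa using this
  rw [D.q_rsmul, hξ, h]

lemma q_compactsOn {S : X →L[ℂ] X} (hS : S ∈ compactsOn A (idealSub X (I : Set A))) (ζ : X) :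
    D.q (S ζ) = 0 := by
  have hcl : IsClosed {S : X →L[ℂ] X | qL D (S ζ) = 0} :=
    isClosed_eq ((qL D).continuous.comp (ContinuousLinearMap.apply ℂ X ζ).continuous)
      continuous_const
  refine closure_minimal (fun S h => ?_) hcl hS
  change D.q (S ζ) = 0
  induction h using Submodule.span_induction with
  | mem x h =>
    obtain ⟨ξ, hξ, η, -, rfl⟩ := h
    rw [rankOne_apply]
    exact rsmul_mem_ker D ((D.q_ker ξ).2 hξ) _
  | zero => simp
  | add x y _ _ hx hy =>
    change D.q (x ζ + y ζ) = 0
    rw [map_add, hx, hy, add_zero]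
  | smul c x _ hx =>
    change D.q (c • x ζ) = 0
    rw [map_smul, hx, smul_zero]

lemma mem_compactsOn {S : adj A X} (hS : S ∈ closure (fin A X : Set (adj A X)))
    (h : Φ D S = 0) : S.1 ∈ compactsOn A (idealSub X (I : Set A)) := by
  have hV : ∀ P : adj A X, Φ D P = 0 → ∀ x, P.1 x ∈ idealSub X (I : Set A) := fun P hP x => by
    rw [← D.q_ker, ← Φ_apply, hP]; rfl
  have hcl : IsClosed (compactsOn A (idealSub X (I : Set A))) := isClosed_closure
  rw [← hcl.closure_eq, Metric.mem_closure_iff]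
  intro ε hε
  obtain ⟨r, hr⟩ := exists_approx S (ε / 2) (half_pos hε)
  refine ⟨(S * star S * (S * r)).1, mul_mul_mem _ (hV S h) (hV _ ?_) (cfin_star hS), ?_⟩
  · rw [map_star, map_mul, h, zero_mul, star_zero]
  · rw [dist_eq_norm]
    exact lt_of_le_of_lt hr (half_lt_self hε)

end Quot

end QuotCompacts

open HilbertModule in
/-- the quotient map `[·]_I : L(X) → L(X_I)` sends `θ_{ξ,η}` to
`θ_{[ξ]_I,[η]_I}`, restricts to a surjection `K(X) → K(X_I)`, and the kernel of this
restriction is `K(XI)`. -/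
theorem stmt3 {A B : Type*} [CStarAlgebra A] [CStarAlgebra B]
    {X Y : Type*} [NormedAddCommGroup X] [NormedSpace ℂ X] [HilbertModule A X]
    [NormedAddCommGroup Y] [NormedSpace ℂ Y] [HilbertModule B Y]
    [CompleteSpace X] [CompleteSpace Y]
    (I : TwoSidedIdeal A) (hI : IsClosed (I : Set A))
    (D : QuotientData A B I X Y) :
    (∀ ξ η ζ : X, rankOne B (D.q ξ) (D.q η) (D.q ζ) = D.q (rankOne A ξ η ζ)) ∧
    (∀ k ∈ compacts B Y, ∃ S ∈ compacts A X, ∀ ζ : X, k (D.q ζ) = D.q (S ζ)) ∧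
    (∀ S ∈ compacts A X,
      ((∀ ζ : X, D.q (S ζ) = 0) ↔ S ∈ compactsOn A (idealSub X (I : Set A)))) := by
  refine ⟨QuotCompacts.q_rankOne D, fun k hk => ?_, fun S hS => ⟨fun h => ?_, fun h => QuotCompacts.q_compactsOn D h⟩⟩
  · rw [QuotCompacts.compacts_eq] at hk
    obtain ⟨k, hk, rfl⟩ := hk
    obtain ⟨T, hT, rfl⟩ := QuotCompacts.exists_lift_closure D hk
    refine ⟨T.1, ?_, QuotCompacts.Φ_apply D T⟩
    rw [QuotCompacts.compacts_eq]
    exact ⟨T, hT, rfl⟩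
  · rw [QuotCompacts.compacts_eq] at hS
    obtain ⟨S, hS, rfl⟩ := hS
    refine QuotCompacts.mem_compactsOn D hS (QuotCompacts.adj_ext_q D fun x => ?_)
    rw [QuotCompacts.Φ_apply, h]
    rfl
end
end

section
/- Let A be a C*-algebra, X a Hilbert A-module, and I₁, I₂ closed ideals of A. If S ∈ L(X_{I₁∩I₂}) satisfies [S]_{I₁/(I₁∩I₂)} ∈ K(X_{I₁}) and [S]_{I₂/(I₁∩I₂)} ∈ K(X_{I₂}), then S ∈ K(X_{I₁∩I₂}). -/
noncomputable section

open HilbertModule Correspondence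

section Helpers

set_option linter.unusedSectionVars false

variable {C : Type*} [CStarAlgebra C] [PartialOrder C] [StarOrderedRing C]
  {Z : Type*} [NormedAddCommGroup Z] [NormedSpace ℂ Z] [HilbertModule C Z]

lemma hm_rankOne_apply (x y z : Z) :
    rankOne C x y z = rsmul x (HilbertModule.inner (A := C) y z) := rfl

lemma hm_exists_a (b : C) (hb : 0 ≤ b) (δ : ℝ) (hδ : 0 < δ) :
    ∃ a : C, star a = a ∧ 0 ≤ a + a - a * b * a ∧
      ‖(1 - b * a) * b * (1 - a * b)‖ ≤ δ := by
  have hsa : IsSelfAdjoint b := IsSelfAdjoint.of_nonneg hb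
  have hsp : ∀ t ∈ spectrum ℝ b, 0 ≤ t := fun t ht => spectrum_nonneg_of_nonneg hb ht
  have hc : ContinuousOn (fun t : ℝ => (t + δ)⁻¹) (spectrum ℝ b) := by
    apply ContinuousOn.inv₀ (by fun_prop)
    intro t ht
    have := hsp t ht
    positivity
  set f : ℝ → ℝ := fun t => (t + δ)⁻¹ with hf
  have hbid : b = cfc (fun t : ℝ => t) b := (cfc_id' ℝ b).symm
  have h1 : (1 : C) = cfc (fun _ : ℝ => (1 : ℝ)) b := (cfc_const_one ℝ b).symm
  have hab : cfc f b * b = cfc (fun t => f t * t) b := by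
    conv_lhs => rw [hbid]
    rw [← hbid, cfc_mul f (fun t => t) b hc (by fun_prop), ← hbid]
  have hba : b * cfc f b = cfc (fun t => t * f t) b := by
    rw [cfc_mul (fun t => t) f b (by fun_prop) hc, ← hbid]
  refine ⟨cfc f b, ?_, ?_, ?_⟩
  · exact (cfc_predicate f b : IsSelfAdjoint _)
  · have : cfc f b + cfc f b - cfc f b * b * cfc f b
        = cfc (fun t => f t + f t - f t * t * f t) b := by
      rw [cfc_sub (fun t => f t + f t) (fun t => f t * t * f t) b (by fun_prop) (by fun_prop),
        cfc_add b f f hc hc, cfc_mul (fun t => f t * t) f b (by fun_prop) hc, hab]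
    rw [this]
    apply cfc_nonneg
    intro t ht
    have h0 := hsp t ht
    have hp : 0 < t + δ := by positivity
    have : f t + f t - f t * t * f t = (t + 2 * δ) / (t + δ) ^ 2 := by
      simp only [hf]; field_simp; ring
    rw [this]; positivity
  · have e1 : (1 - b * cfc f b) = cfc (fun t => 1 - t * f t) b := by
      rw [cfc_sub (fun _ => 1) (fun t => t * f t) b (by fun_prop) (by fun_prop), ← h1, hba]
    have e2 : (1 - cfc f b * b) = cfc (fun t => 1 - f t * t) b := by
      rw [cfc_sub (fun _ => 1) (fun t => f t * t) b (by fun_prop) (by fun_prop), ← h1, hab]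
    have e3 : (1 - b * cfc f b) * b * (1 - cfc f b * b)
        = cfc (fun t => (1 - t * f t) * t * (1 - f t * t)) b := by
      rw [cfc_mul (fun t => (1 - t * f t) * t) (fun t => 1 - f t * t) b (by fun_prop)
        (by fun_prop), cfc_mul (fun t => (1 - t * f t)) (fun t => t) b (by fun_prop)
        (by fun_prop), ← hbid, e1, e2]
    rw [e3]
    apply norm_cfc_le hδ.le
    intro t ht
    have h0 := hsp t ht
    have hp : 0 < t + δ := by positivity
    have : (1 - t * f t) * t * (1 - f t * t) = δ * (δ * t / (t + δ) ^ 2) := by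
      simp only [hf]; field_simp; ring
    rw [this, Real.norm_of_nonneg (by positivity)]
    apply mul_le_of_le_one_right hδ.le
    rw [div_le_one (by positivity)]
    nlinarith

variable (C) in
/-- contractive module maps that are the identity minus a finite-rank operator -/
structure HMGood (N : Z →L[ℂ] Z) : Prop where
  fin : (1 - N) ∈ Submodule.span ℂ {T : Z →L[ℂ] Z | ∃ ξ η : Z, T = rankOne C ξ η}
  contr : ∀ z, HilbertModule.inner (A := C) (N z) (N z) ≤ HilbertModule.inner (A := C) z z
  lin : ∀ (z : Z) (c : C), N (rsmul z c) = rsmul (N z) c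

lemma HMGood.one : HMGood C (1 : Z →L[ℂ] Z) := ⟨by simp, fun _ => le_rfl, fun _ _ => rfl⟩

lemma HMGood.mul {N M : Z →L[ℂ] Z} (hN : HMGood C N) (hM : HMGood C M) :
    HMGood C (N * M) := by
  refine ⟨?_, fun z => (hN.contr (M z)).trans (hM.contr z), fun z c => ?_⟩
  · have : 1 - N * M = (1 - N) + N * (1 - M) := by rw [mul_sub, mul_one]; abel
    rw [this]
    refine Submodule.add_mem _ hN.fin ?_
    have := hM.fin
    generalize (1 - M) = R at this
    induction this using Submodule.span_induction with
    | mem T hT =>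
      obtain ⟨ξ, η, rfl⟩ := hT
      apply Submodule.subset_span
      refine ⟨N ξ, η, ?_⟩
      ext z
      simp [hm_rankOne_apply, hN.lin]
    | zero => simp
    | add x y _ _ hx hy => rw [mul_add]; exact Submodule.add_mem _ hx hy
    | smul c x _ hx => rw [mul_smul_comm]; exact Submodule.smul_mem _ _ hx
  · simp [hM.lin, hN.lin]

lemma hm_norm_le_of_inner {x y : Z}
    (hx : 0 ≤ HilbertModule.inner (A := C) x x)
    (h : HilbertModule.inner (A := C) x x ≤ HilbertModule.inner (A := C) y y) :
    ‖x‖ ≤ ‖y‖ := by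
  have := CStarAlgebra.norm_le_norm_of_nonneg_of_le hx h
  rw [← norm_sq_inner, ← norm_sq_inner] at this
  exact le_of_sq_le_sq this (norm_nonneg _)

lemma hm_inner_nonneg (x : Z) : 0 ≤ HilbertModule.inner (A := C) x x := by
  obtain ⟨b, hb⟩ := inner_self_isPositive (A := C) x
  rw [hb]; exact star_mul_self_nonneg b

lemma HMGood.norm_le {N : Z →L[ℂ] Z} (hN : HMGood C N) (z : Z) : ‖N z‖ ≤ ‖z‖ :=
  hm_norm_le_of_inner (C := C) (hm_inner_nonneg _) (hN.contr z)

lemma hm_inner_neg_right (x y : Z) :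
    HilbertModule.inner (A := C) x (-y) = -HilbertModule.inner (A := C) x y := by
  have := inner_csmul_right (A := C) (-1) x y
  simpa using this

lemma hm_inner_sub_right (x y z : Z) : HilbertModule.inner (A := C) x (y - z) =
    HilbertModule.inner (A := C) x y - HilbertModule.inner (A := C) x z := by
  rw [sub_eq_add_neg, HilbertModule.inner_add_right, hm_inner_neg_right, sub_eq_add_neg]

lemma hm_inner_sub_left (x y z : Z) : HilbertModule.inner (A := C) (x - y) z =
    HilbertModule.inner (A := C) x z - HilbertModule.inner (A := C) y z := by
  rw [← star_inner, hm_inner_sub_right, star_sub, star_inner, star_inner]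

lemma hm_inner_rsmul_left (x y : Z) (a : C) : HilbertModule.inner (A := C) (rsmul x a) y =
    star a * HilbertModule.inner (A := C) x y := by
  rw [← star_inner, inner_rsmul_right, star_mul, star_inner]

lemma hm_rsmul_neg_left (x : Z) (c : C) : rsmul (-x) c = -rsmul x c := by
  have := rsmul_csmul_left (-1) x c
  simpa using this

/-- one vector can be made small by a good operator -/
lemma hm_exists_good (x : Z) (ε : ℝ) (hε : 0 < ε) :
    ∃ N : Z →L[ℂ] Z, HMGood C N ∧ ‖N x‖ ≤ ε := by
  obtain ⟨a, ha, hpos, hn⟩ := hm_exists_a (HilbertModule.inner (A := C) x x)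
    (hm_inner_nonneg x) (ε ^ 2) (by positivity)
  refine ⟨1 - rankOne C (rsmul x a) x, ⟨?_, ?_, ?_⟩, ?_⟩
  · rw [sub_sub_cancel]
    exact Submodule.subset_span ⟨_, _, rfl⟩
  · intro z
    have hz : (1 - rankOne C (rsmul x a) x) z
        = z - rsmul x (a * HilbertModule.inner (A := C) x z) := by
      simp [hm_rankOne_apply, rsmul_rsmul]
    rw [hz, ← sub_nonneg]
    have := star_left_conjugate_nonneg hpos (HilbertModule.inner (A := C) x z)
    convert this using 1
    simp only [hm_inner_sub_right, hm_inner_sub_left, hm_inner_rsmul_left, inner_rsmul_right,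
      star_mul, ha, star_inner]
    noncomm_ring
  · intro z c
    have h1 : rsmul (z - rsmul x (a * HilbertModule.inner (A := C) x z)) c =
        rsmul z c - rsmul (rsmul x (a * HilbertModule.inner (A := C) x z)) c := by
      rw [sub_eq_add_neg, rsmul_add_left, hm_rsmul_neg_left, sub_eq_add_neg]
    simp [hm_rankOne_apply, rsmul_rsmul, h1, inner_rsmul_right, mul_assoc]
  · have hz : (1 - rankOne C (rsmul x a) x) x
        = x - rsmul x (a * HilbertModule.inner (A := C) x x) := by
      simp [hm_rankOne_apply, rsmul_rsmul]
    rw [hz]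
    apply le_of_sq_le_sq _ hε.le
    rw [norm_sq_inner (A := C)]
    refine le_trans (le_of_eq (congrArg norm ?_)) hn
    simp only [hm_inner_sub_right, hm_inner_sub_left, hm_inner_rsmul_left, inner_rsmul_right,
      star_mul, ha, star_inner]
    noncomm_ring

lemma hm_exists_good_op (G : Z →L[ℂ] Z)
    (hG : G ∈ Submodule.span ℂ {T : Z →L[ℂ] Z | ∃ ξ η : Z, T = rankOne C ξ η}) :
    ∀ N₀ : Z →L[ℂ] Z, HMGood C N₀ → ∀ ε : ℝ, 0 < ε →
      ∃ N : Z →L[ℂ] Z, HMGood C N ∧ ∀ z, ‖N (N₀ (G z))‖ ≤ ε * ‖z‖ := by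
  induction hG using Submodule.span_induction with
  | mem T hT =>
    obtain ⟨ξ, η, rfl⟩ := hT
    intro N₀ h₀ ε hε
    obtain ⟨N, hN, hs⟩ := hm_exists_good (C := C) (N₀ ξ) (ε / (‖η‖ + 1)) (by positivity)
    refine ⟨N, hN, fun z => ?_⟩
    rw [hm_rankOne_apply, h₀.lin, hN.lin]
    calc _ ≤ ‖N (N₀ ξ)‖ * ‖HilbertModule.inner (A := C) η z‖ := norm_rsmul_le _ _
      _ ≤ (ε / (‖η‖ + 1)) * ((‖η‖ + 1) * ‖z‖) := by
        gcongr
        refine (norm_inner_le (A := C) η z).trans ?_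
        gcongr
        linarith
      _ = ε * ‖z‖ := by field_simp
  | zero =>
    intro N₀ h₀ ε hε
    exact ⟨1, HMGood.one, fun z => by simp; positivity⟩
  | add x y _ _ hx hy =>
    intro N₀ h₀ ε hε
    obtain ⟨N, hN, h1⟩ := hx N₀ h₀ (ε / 2) (by positivity)
    obtain ⟨M, hM, h2⟩ := hy (N * N₀) (hN.mul h₀) (ε / 2) (by positivity)
    refine ⟨M * N, hM.mul hN, fun z => ?_⟩
    have e : (M * N) (N₀ ((x + y) z)) = M (N (N₀ (x z))) + M ((N * N₀) (y z)) := by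
      simp
    rw [e]
    refine (norm_add_le _ _).trans ?_
    have := (hM.norm_le (N (N₀ (x z)))).trans (h1 z)
    have := h2 z
    linarith
  | smul c x _ hx =>
    intro N₀ h₀ ε hε
    obtain ⟨N, hN, h1⟩ := hx N₀ h₀ (ε / (‖c‖ + 1)) (by positivity)
    refine ⟨N, hN, fun z => ?_⟩
    have e : N (N₀ ((c • x) z)) = c • N (N₀ (x z)) := by simp
    rw [e, norm_smul]
    calc _ ≤ (‖c‖ + 1) * ((ε / (‖c‖ + 1)) * ‖z‖) := by
          gcongr
          · linarith
          · exact h1 z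
      _ = ε * ‖z‖ := by field_simp

variable {B : Type*} [CStarAlgebra B] [PartialOrder B] [StarOrderedRing B]
  {Y : Type*} [NormedAddCommGroup Y] [NormedSpace ℂ Y] [HilbertModule B Y]
  {J : TwoSidedIdeal C}

lemma hm_lift (E : QuotientData C B J Z Y) (F : Y →L[ℂ] Y)
    (hF : F ∈ Submodule.span ℂ {T : Y →L[ℂ] Y | ∃ ξ η : Y, T = rankOne B ξ η}) :
    ∃ G ∈ Submodule.span ℂ {T : Z →L[ℂ] Z | ∃ ξ η : Z, T = rankOne C ξ η},
      ∀ z, E.q (G z) = F (E.q z) := by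
  induction hF using Submodule.span_induction with
  | mem T hT =>
    obtain ⟨ξ, η, rfl⟩ := hT
    obtain ⟨x, rfl⟩ := E.q_surjective ξ
    obtain ⟨y, rfl⟩ := E.q_surjective η
    refine ⟨rankOne C x y, Submodule.subset_span ⟨_, _, rfl⟩, fun z => ?_⟩
    change E.q (rsmul x _) = rsmul (E.q x) _
    rw [E.q_rsmul, E.q_inner]
  | zero => exact ⟨0, Submodule.zero_mem _, fun z => by simp⟩
  | add x y _ _ hx hy =>
    obtain ⟨G, hG, h1⟩ := hx
    obtain ⟨H, hH, h2⟩ := hy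
    exact ⟨G + H, Submodule.add_mem _ hG hH, fun z => by simp [h1, h2]⟩
  | smul c x _ hx =>
    obtain ⟨G, hG, h1⟩ := hx
    exact ⟨c • G, Submodule.smul_mem _ _ hG, fun z => by simp [h1]⟩

lemma hm_q_norm_le (E : QuotientData C B J Z Y) (z : Z) : ‖E.q z‖ ≤ ‖z‖ := by
  apply le_of_sq_le_sq _ (norm_nonneg _)
  rw [norm_sq_inner (A := B), norm_sq_inner (A := C), E.q_inner]
  exact NonUnitalStarAlgHom.norm_apply_le E.π _

lemma hm_q_good (E : QuotientData C B J Z Y) {N : Z →L[ℂ] Z} (hN : HMGood C N) (z : Z) :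
    ‖E.q (N z)‖ ≤ ‖E.q z‖ := by
  apply hm_norm_le_of_inner (C := B) (hm_inner_nonneg _)
  rw [E.q_inner, E.q_inner]
  exact OrderHomClass.mono E.π (hN.contr z)

/-- key estimate in one quotient -/
lemma hm_est (E : QuotientData C B J Z Y) (S : Z →L[ℂ] Z) (T F : Y →L[ℂ] Y) (G : Z →L[ℂ] Z)
    (hT : ∀ z : Z, T (E.q z) = E.q (S z)) (hG : ∀ z, E.q (G z) = F (E.q z))
    (ε : ℝ) (hTF : ‖T - F‖ ≤ ε) (N : Z →L[ℂ] Z) (hN : HMGood C N)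
    (hNG : ∀ z, ‖N (G z)‖ ≤ ε * ‖z‖) (z : Z) : ‖E.q (N (S z))‖ ≤ 2 * ε * ‖z‖ := by
  have e : E.q (N (S z)) = E.q (N (S z - G z)) + E.q (N (G z)) := by
    rw [← map_add, ← map_add, sub_add_cancel]
  have h1 : ‖E.q (N (S z - G z))‖ ≤ ε * ‖z‖ := by
    refine (hm_q_good E hN _).trans ?_
    have : E.q (S z - G z) = (T - F) (E.q z) := by simp [hT, hG]
    rw [this]
    refine ((T - F).le_opNorm _).trans ?_
    have := hm_q_norm_le E z
    have := (norm_nonneg (T - F)).trans hTF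
    gcongr
  have h2 := (hm_q_norm_le E (N (G z))).trans (hNG z)
  rw [e]
  refine (norm_add_le _ _).trans ?_
  linarith

end Helpers

open HilbertModule in
/-- if `S ∈ L(X_{I₁∩I₂})` has compact images in both `L(X_{I₁})` and
`L(X_{I₂})`, then `S` is compact. -/
theorem stmt6 {A C B₁ B₂ : Type*} [CStarAlgebra A] [CStarAlgebra C]
    [CStarAlgebra B₁] [CStarAlgebra B₂]
    {X Z Y₁ Y₂ : Type*}
    [NormedAddCommGroup X] [NormedSpace ℂ X] [HilbertModule A X]
    [NormedAddCommGroup Z] [NormedSpace ℂ Z] [HilbertModule C Z]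
    [NormedAddCommGroup Y₁] [NormedSpace ℂ Y₁] [HilbertModule B₁ Y₁]
    [NormedAddCommGroup Y₂] [NormedSpace ℂ Y₂] [HilbertModule B₂ Y₂]
    [CompleteSpace X] [CompleteSpace Z] [CompleteSpace Y₁] [CompleteSpace Y₂]
    (I₁ I₂ : TwoSidedIdeal A)
    (hI₁ : IsClosed (I₁ : Set A)) (hI₂ : IsClosed (I₂ : Set A))
    (D : QuotientData A C (I₁ ⊓ I₂) X Z)     -- `Z = X_{I₁∩I₂}`
    (J₁ J₂ : TwoSidedIdeal C)                -- `Jᵢ = Iᵢ/(I₁∩I₂)`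
    (hJ₁ : (J₁ : Set C) = ⇑D.π '' (I₁ : Set A))
    (hJ₂ : (J₂ : Set C) = ⇑D.π '' (I₂ : Set A))
    (E₁ : QuotientData C B₁ J₁ Z Y₁)         -- `Y₁ = X_{I₁}`
    (E₂ : QuotientData C B₂ J₂ Z Y₂)         -- `Y₂ = X_{I₂}`
    (S : Z →L[ℂ] Z) (hS : IsAdjointable C S)
    (T₁ : Y₁ →L[ℂ] Y₁) (hT₁q : ∀ z : Z, T₁ (E₁.q z) = E₁.q (S z))
    (hT₁ : T₁ ∈ compacts B₁ Y₁)
    (T₂ : Y₂ →L[ℂ] Y₂) (hT₂q : ∀ z : Z, T₂ (E₂.q z) = E₂.q (S z))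
    (hT₂ : T₂ ∈ compacts B₂ Y₂) :
    S ∈ compacts C Z := by
  let _ := CStarAlgebra.spectralOrder C
  let _ := CStarAlgebra.spectralOrder B₁
  let _ := CStarAlgebra.spectralOrder B₂
  have := CStarAlgebra.spectralOrderedRing C
  have := CStarAlgebra.spectralOrderedRing B₁
  have := CStarAlgebra.spectralOrderedRing B₂
  -- the intersection of `J₁` and `J₂` is zero
  have hJ : ∀ c : C, c ∈ J₁ → c ∈ J₂ → c = 0 := by
    intro c h1 h2
    have h1' : c ∈ (J₁ : Set C) := h1
    have h2' : c ∈ (J₂ : Set C) := h2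
    rw [hJ₁] at h1'
    rw [hJ₂] at h2'
    obtain ⟨a, ha, rfl⟩ := h1'
    obtain ⟨b, hb, hab⟩ := h2'
    have hd : b - a ∈ I₁ ⊓ I₂ := by rw [← D.π_ker, map_sub, hab, sub_self]
    rw [TwoSidedIdeal.mem_inf] at hd
    have ha2 : a ∈ I₂ := by
      have := I₂.sub_mem hb hd.2
      simpa using this
    rw [D.π_ker, TwoSidedIdeal.mem_inf]
    exact ⟨ha, ha2⟩
  have hinj : Function.Injective (E₁.π.prod E₂.π) := by
    rw [injective_iff_map_eq_zero]
    intro c hc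
    have h1 : E₁.π c = 0 := congrArg Prod.fst hc
    have h2 : E₂.π c = 0 := congrArg Prod.snd hc
    exact hJ c ((E₁.π_ker c).1 h1) ((E₂.π_ker c).1 h2)
  have hnorm : ∀ (w : Z) (M : ℝ), ‖E₁.q w‖ ≤ M → ‖E₂.q w‖ ≤ M → ‖w‖ ≤ M := by
    intro w M h1 h2
    have hM : 0 ≤ M := (norm_nonneg _).trans h1
    apply le_of_sq_le_sq _ hM
    rw [norm_sq_inner (A := C), ← NonUnitalStarAlgHom.norm_map (E₁.π.prod E₂.π) hinj]
    have e1 : ‖E₁.π (HilbertModule.inner (A := C) w w)‖ ≤ M ^ 2 := by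
      rw [← E₁.q_inner, ← norm_sq_inner]; gcongr
    have e2 : ‖E₂.π (HilbertModule.inner (A := C) w w)‖ ≤ M ^ 2 := by
      rw [← E₂.q_inner, ← norm_sq_inner]; gcongr
    exact max_le e1 e2
  obtain ⟨S', hS'⟩ := hS
  unfold compacts at hT₁ hT₂ ⊢
  rw [Metric.mem_closure_iff] at hT₁ hT₂ ⊢
  intro ε hε
  obtain ⟨F₁, hF₁, hd₁⟩ := hT₁ (ε / 4) (by positivity)
  obtain ⟨F₂, hF₂, hd₂⟩ := hT₂ (ε / 4) (by positivity)
  rw [dist_eq_norm] at hd₁ hd₂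
  obtain ⟨G₁, hG₁, hq₁⟩ := hm_lift E₁ F₁ hF₁
  obtain ⟨G₂, hG₂, hq₂⟩ := hm_lift E₂ F₂ hF₂
  obtain ⟨N₁, hN₁, hs₁⟩ := hm_exists_good_op G₁ hG₁ 1 HMGood.one (ε / 4) (by positivity)
  obtain ⟨N₂, hN₂, hs₂⟩ := hm_exists_good_op G₂ hG₂ N₁ hN₁ (ε / 4) (by positivity)
  have hN := hN₂.mul hN₁
  have b₁ := hm_est E₁ S T₁ F₁ G₁ hT₁q hq₁ (ε / 4) hd₁.le (N₂ * N₁) hN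
    (fun z => (hN₂.norm_le _).trans (hs₁ z))
  have b₂ := hm_est E₂ S T₂ F₂ G₂ hT₂q hq₂ (ε / 4) hd₂.le (N₂ * N₁) hN hs₂
  refine ⟨(1 - N₂ * N₁) * S, ?_, ?_⟩
  · have := hN.fin
    change _ ∈ Submodule.span ℂ _
    generalize (1 - N₂ * N₁) = R at this
    induction this using Submodule.span_induction with
    | mem T hT =>
      obtain ⟨ξ, η, rfl⟩ := hT
      apply Submodule.subset_span
      refine ⟨ξ, S' η, ?_⟩
      ext z
      have : HilbertModule.inner (A := C) η (S z) = HilbertModule.inner (A := C) (S' η) z := by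
        rw [← star_inner, hS', star_inner]
      simp [hm_rankOne_apply, this]
    | zero => simp
    | add x y _ _ hx hy => rw [add_mul]; exact Submodule.add_mem _ hx hy
    | smul c x _ hx => rw [smul_mul_assoc]; exact Submodule.smul_mem _ _ hx
  · rw [dist_eq_norm]
    have e : S - (1 - N₂ * N₁) * S = (N₂ * N₁) * S := by rw [sub_mul, one_mul]; abel
    rw [e]
    refine lt_of_le_of_lt (ContinuousLinearMap.opNorm_le_bound _ (M := ε / 2) (by positivity)
      (fun z => ?_)) (half_lt_self hε)
    have h := hnorm _ _ (b₁ z) (b₂ z)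
    refine h.trans (le_of_eq ?_)
    ring
end
end

section
/- Let X be a C*-correspondence over a C*-algebra A with left action φ_X : A → L(X), let {Iₙ}ₙ∈ℕ be an increasing family of closed ideals of A with I_∞ the closure of their union, and let J be a closed ideal of A with φ_X(J) ⊂ K(X). Then J ∩ X⁻¹(I_∞) equals the closure of ⋃ₙ (J ∩ X⁻¹(Iₙ)). -/
noncomputable section

open HilbertModule Correspondence

section Aux8
open HilbertModule Correspondence Filter Topology

variable {A : Type*} [CStarAlgebra A] {X : Type*} [NormedAddCommGroup X]
    [NormedSpace ℂ X] [Correspondence A X]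

lemma aux_csmul_mem (I : TwoSidedIdeal A) (c : ℂ) {x : A} (hx : x ∈ I) : c • x ∈ I := by
  have := I.mul_mem_left (c • (1 : A)) x hx
  simpa using this

lemma aux_inner_csmul_left (c : ℂ) (x y : X) :
    HilbertModule.inner (A := A) (c • x) y = star c • HilbertModule.inner (A := A) x y := by
  rw [← star_inner, inner_csmul_right, star_smul, star_inner]

lemma aux_inner_zero_right (x : X) : HilbertModule.inner (A := A) x (0 : X) = 0 := by
  have := inner_csmul_right (A := A) (0 : ℂ) x (0 : X)
  simpa using this

/-- inner product on the right as a continuous linear map -/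
def auxInner (A : Type*) {X : Type*} [CStarAlgebra A] [NormedAddCommGroup X]
    [NormedSpace ℂ X] [Correspondence A X] (x : X) : X →L[ℂ] A :=
  LinearMap.mkContinuous
    { toFun := fun y => HilbertModule.inner (A := A) x y
      map_add' := fun y z => inner_add_right x y z
      map_smul' := fun c y => inner_csmul_right c x y } ‖x‖ (norm_inner_le x)

lemma auxInner_apply (x y : X) : auxInner A x y = HilbertModule.inner (A := A) x y := rfl

/-- operators with all coefficients in `I` -/
def auxM (X : Type*) {A : Type*} [CStarAlgebra A] [NormedAddCommGroup X]
    [NormedSpace ℂ X] [Correspondence A X] (I : TwoSidedIdeal A) : Submodule ℂ (X →L[ℂ] X) where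
  carrier := {T | ∀ ξ η : X, auxInner A η (T ξ) ∈ I}
  add_mem' := fun {S T} hS hT ξ η => by
    simp only [add_apply, map_add]
    exact I.add_mem (hS ξ η) (hT ξ η)
  zero_mem' := fun ξ η => by simp [I.zero_mem]
  smul_mem' := fun c T hT ξ η => by
    simp only [smul_apply, map_smul]
    exact aux_csmul_mem I c (hT ξ η)

lemma auxM_mem {I : TwoSidedIdeal A} {T : X →L[ℂ] X} :
    T ∈ auxM X I ↔ ∀ ξ η : X, auxInner A η (T ξ) ∈ I := Iff.rfl

lemma lact_apply (a : A) (x : X) : lact A a x = lsmul a x := rfl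

lemma aux_lact_mul (a b : A) : lact A (X := X) (a * b) = lact A a * lact A b := by
  ext x; exact lsmul_mul a b x

lemma auxM_lact_mul {I : TwoSidedIdeal A} {T : X →L[ℂ] X} (hT : T ∈ auxM X I) (a : A) :
    lact A a * T ∈ auxM X I := by
  intro ξ η
  have := inner_lsmul_left (star a) η (T ξ)
  rw [star_star] at this
  have h2 : auxInner A η ((lact A a * T : X →L[ℂ] X) ξ) = auxInner A (lsmul (star a) η) (T ξ) := this.symm
  rw [h2]
  exact hT ξ _

lemma auxM_mul {I : TwoSidedIdeal A} {T : X →L[ℂ] X} (hT : T ∈ auxM X I) (S : X →L[ℂ] X) :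
    T * S ∈ auxM X I := fun ξ η => hT (S ξ) η

lemma aux_pow {I : TwoSidedIdeal A} {p : A} {r : X →L[ℂ] X} (h : lact A p - r ∈ auxM X I)
    (N : ℕ) : lact A p ^ N - r ^ N ∈ auxM X I := by
  induction N with
  | zero => simp
  | succ N ih =>
    have e : lact A p ^ (N+1) - r ^ (N+1)
        = lact A p * (lact A p ^ N - r ^ N) + (lact A p - r) * r ^ N := by
      rw [pow_succ', pow_succ']; noncomm_ring
    rw [e]
    exact add_mem (auxM_lact_mul ih p) (auxM_mul h _)

lemma aux_lact_pow_mul (p b : A) (N : ℕ) :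
    lact A (X := X) (p ^ N * b) = lact A p ^ N * lact A b := by
  induction N with
  | zero => simp
  | succ N ih => rw [pow_succ', mul_assoc, aux_lact_mul, ih, pow_succ', mul_assoc]

/-- `d ↦ θ_{x d, w}` as a continuous linear map. -/
def auxTheta (x w : X) : A →L[ℂ] (X →L[ℂ] X) :=
  LinearMap.mkContinuous
    { toFun := fun d => rankOne A (rsmul x d) w
      map_add' := fun d e => by
        ext z
        change rsmul (rsmul x (d + e)) _ = rsmul (rsmul x d) _ + rsmul (rsmul x e) _
        rw [rsmul_add_right, rsmul_add_left]
      map_smul' := fun c d => by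
        ext z
        change rsmul (rsmul x (c • d)) _ = c • rsmul (rsmul x d) _
        rw [rsmul_csmul_right, rsmul_csmul_left] }
    (‖x‖ * ‖w‖) (fun d => by
      have hb : ‖rankOne A (rsmul x d) w‖ ≤ ‖rsmul x d‖ * ‖w‖ :=
        LinearMap.mkContinuous_norm_le _ (mul_nonneg (norm_nonneg _) (norm_nonneg _)) _
      refine hb.trans ?_
      calc ‖rsmul x d‖ * ‖w‖ ≤ (‖x‖ * ‖d‖) * ‖w‖ := by
            gcongr; exact norm_rsmul_le _ _
        _ = _ := by ring)

lemma auxTheta_mem {I : TwoSidedIdeal A} {d : A} (hd : d ∈ I) (x w : X) :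
    auxTheta x w d ∈ auxM X I := by
  intro ξ η
  change HilbertModule.inner (A := A) η (rsmul (rsmul x d) (HilbertModule.inner (A := A) w ξ)) ∈ I
  rw [inner_rsmul_right, inner_rsmul_right]
  exact I.mul_mem_right _ _ (I.mul_mem_left _ _ hd)

lemma auxTheta_eq (x y z w : X) (c : A) :
    rankOne A x y * (lact A c * rankOne A z w)
      = auxTheta x w (HilbertModule.inner (A := A) y (lsmul c z)) := by
  ext ξ
  change rsmul x (HilbertModule.inner (A := A) y
    (lsmul c (rsmul z (HilbertModule.inner (A := A) w ξ)))) =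
    rsmul (rsmul x _) (HilbertModule.inner (A := A) w ξ)
  rw [lsmul_rsmul, inner_rsmul_right, rsmul_rsmul]

/-- closed span of the `M_n` -/
def auxL (X : Type*) {A : Type*} [CStarAlgebra A] [NormedAddCommGroup X]
    [NormedSpace ℂ X] [Correspondence A X] (I : ℕ → TwoSidedIdeal A) :
    Submodule ℂ (X →L[ℂ] X) :=
  (⨆ n, auxM X (I n)).topologicalClosure

lemma aux_span {E F : Type*} [NormedAddCommGroup E] [NormedSpace ℂ E] [NormedAddCommGroup F]
    [NormedSpace ℂ F] (L : Submodule ℂ F) (hL : IsClosed (L : Set F)) (f : E →L[ℂ] F)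
    (s : Set E) (hs : ∀ x ∈ s, f x ∈ L) {x : E}
    (hx : x ∈ closure (Submodule.span ℂ s : Set E)) : f x ∈ L := by
  have h1 : Submodule.span ℂ s ≤ L.comap (f : E →ₗ[ℂ] F) := Submodule.span_le.2 hs
  have h2 : IsClosed ((L.comap (f : E →ₗ[ℂ] F) : Submodule ℂ E) : Set E) :=
    hL.preimage f.continuous
  exact closure_minimal h1 h2 hx

lemma auxL_closed (I : ℕ → TwoSidedIdeal A) : IsClosed (auxL X I : Set (X →L[ℂ] X)) :=
  Submodule.isClosed_topologicalClosure _

lemma aux_sandwich (I : ℕ → TwoSidedIdeal A) (c : A)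
    (hc : c ∈ corrInv X (closure (⋃ n, ((I n : Set A))))) {S T : X →L[ℂ] X}
    (hS : S ∈ compacts A X) (hT : T ∈ compacts A X) :
    S * (lact A c * T) ∈ auxL X I := by
  have hcl := auxL_closed (X := X) I
  have key : ∀ x y z w : X, rankOne A x y * (lact A c * rankOne A z w) ∈ auxL X I := by
    intro x y z w
    rw [auxTheta_eq]
    have := hc z y
    refine closure_minimal (s := ⋃ n, ((I n : Set A))) (t := auxTheta x w ⁻¹' (auxL X I : Set _))
      ?_ (hcl.preimage (auxTheta x w).continuous) this
    intro d hd
    obtain ⟨n, hn⟩ := Set.mem_iUnion.1 hd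
    exact Submodule.le_topologicalClosure _ (Submodule.mem_iSup_of_mem n (auxTheta_mem hn x w))
  have step : ∀ x y : X, rankOne A x y * (lact A c * T) ∈ auxL X I := by
    intro x y
    refine aux_span (auxL X I) hcl
      ((ContinuousLinearMap.mul ℂ (X →L[ℂ] X) (rankOne A x y)).comp
        (ContinuousLinearMap.mul ℂ (X →L[ℂ] X) (lact A c))) _ ?_ hT
    rintro _ ⟨z, w, rfl⟩
    exact key x y z w
  refine aux_span (auxL X I) hcl
      ((ContinuousLinearMap.mul ℂ (X →L[ℂ] X)).flip (lact A c * T)) _ ?_ hS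
  rintro _ ⟨x, y, rfl⟩
  exact step x y

lemma aux_approx (I : ℕ → TwoSidedIdeal A) (hmono : Monotone I) {T : X →L[ℂ] X}
    (hT : T ∈ auxL X I) {ε : ℝ} (hε : 0 < ε) :
    ∃ n, ∃ r : X →L[ℂ] X, ‖r‖ ≤ ε ∧ T - r ∈ auxM X (I n) := by
  have hT' : T ∈ closure ((⨆ n, auxM X (I n) : Submodule ℂ (X →L[ℂ] X)) : Set (X →L[ℂ] X)) := hT
  obtain ⟨k, hk, hd⟩ := Metric.mem_closure_iff.1 hT' ε hε
  have hdir : Directed (· ≤ ·) (fun n => auxM X (I n)) := by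
    apply Monotone.directed_le
    intro m n hmn T hT ξ η
    exact hmono hmn (hT ξ η)
  obtain ⟨n, hn⟩ := (Submodule.mem_iSup_of_directed _ hdir).1 hk
  refine ⟨n, T - k, ?_, by simpa using hn⟩
  rw [← dist_eq_norm]; exact hd.le

lemma norm_lact_le (a : A) : ‖lact A (X := X) a‖ ≤ ‖a‖ :=
  LinearMap.mkContinuous_norm_le _ (norm_nonneg _) _

/-- the cutoff function -/
def auxG (δ t : ℝ) : ℝ := min 1 (max 0 (t / (2 * δ) - 1))

lemma auxG_cont (δ : ℝ) : Continuous (auxG δ) := by unfold auxG; fun_prop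

lemma aux_cut (I : TwoSidedIdeal A) (hI : IsClosed (I : Set A)) (h : A) (hsa : IsSelfAdjoint h)
    {δ : ℝ} (hδ : 0 < δ) {r : X →L[ℂ] X} (hr : ‖r‖ ≤ δ ^ 3)
    (hr' : lact A (h ^ 3) - r ∈ auxM X I) :
    lact A (cfc (auxG δ) h) ∈ auxM X I := by
  intro ξ η
  have hcont : ∀ N : ℕ, Continuous (fun t : ℝ => auxG δ t * ((max t (2 * δ)) ^ (3 * N))⁻¹) := by
    intro N
    refine (auxG_cont δ).mul (Continuous.inv₀ (by fun_prop) ?_)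
    intro t
    have : 0 < max t (2 * δ) := lt_max_of_lt_right (by positivity)
    positivity
  set H : ℕ → A := fun N => cfc (fun t : ℝ => auxG δ t * ((max t (2 * δ)) ^ (3 * N))⁻¹) h with hH
  have hfac : ∀ N, cfc (auxG δ) h = (h ^ 3) ^ N * H N := by
    intro N
    have e1 : (h ^ 3) ^ N = cfc (fun t : ℝ => t ^ (3 * N)) h := by
      rw [cfc_pow_id (R := ℝ) h (3 * N), pow_mul]
    rw [e1, hH, ← cfc_mul (fun t : ℝ => t ^ (3 * N)) _ h (by fun_prop) (hcont N).continuousOn]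
    congr 1
    ext t
    rcases le_or_gt t (2 * δ) with ht | ht
    · have : auxG δ t = 0 := by
        unfold auxG
        have : t / (2 * δ) - 1 ≤ 0 := by
          rw [sub_nonpos, div_le_one (by positivity)]; exact ht
        rw [max_eq_left this]; simp
      simp [this]
    · rw [max_eq_left ht.le]
      have : t ≠ 0 := by linarith [hδ, ht] |> fun (h : 0 < t) => h.ne'
      field_simp
  have hHn : ∀ N, ‖H N‖ ≤ ((2 * δ) ^ (3 * N))⁻¹ := by
    intro N
    refine norm_cfc_le (by positivity) ?_
    intro t _
    have h0 : 0 ≤ auxG δ t := le_min zero_le_one (le_max_left _ _)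
    have h1 : auxG δ t ≤ 1 := min_le_left _ _
    have hp : 0 < max t (2 * δ) := lt_max_of_lt_right (by positivity)
    rw [Real.norm_of_nonneg (by positivity)]
    calc auxG δ t * ((max t (2 * δ)) ^ (3 * N))⁻¹ ≤ 1 * ((2 * δ) ^ (3 * N))⁻¹ := by
          gcongr
          exact le_max_right _ _
      _ = _ := one_mul _
  have hlim : Tendsto (fun N : ℕ => auxInner A η (lact A (cfc (auxG δ) h) ξ)
      - auxInner A η ((r ^ N * lact A (H N) : X →L[ℂ] X) ξ)) atTop
      (𝓝 (auxInner A η (lact A (cfc (auxG δ) h) ξ) - 0)) := by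
    refine tendsto_const_nhds.sub ?_
    refine squeeze_zero_norm (a := fun N : ℕ => ‖auxInner A η‖ * ((1/8 : ℝ) ^ N * ‖ξ‖)) ?_ ?_
    · intro N
      have hrN : ‖(r ^ N * lact A (H N))‖ ≤ (1/8 : ℝ) ^ N := by
        have b1 : ‖r ^ N * lact A (H N)‖ ≤ ‖r ^ N‖ * ‖lact A (X := X) (H N)‖ := norm_mul_le _ _
        have b2 : ‖r ^ N‖ ≤ (δ ^ 3) ^ N := by
          rcases Nat.eq_zero_or_pos N with rfl | hN
          · rw [pow_zero, pow_zero]; exact ContinuousLinearMap.norm_id_le (𝕜 := ℂ) (E := X)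
          · exact (norm_pow_le' r hN).trans (by gcongr)
        have b3 : ‖lact A (X := X) (H N)‖ ≤ ((2 * δ) ^ (3 * N))⁻¹ :=
          (norm_lact_le _).trans (hHn N)
        calc _ ≤ _ := b1
          _ ≤ (δ ^ 3) ^ N * ((2 * δ) ^ (3 * N))⁻¹ := by gcongr
          _ = (1/8 : ℝ) ^ N := by
            rw [pow_mul, ← inv_pow, ← mul_pow]
            congr 1
            field_simp
            norm_num
      calc _ ≤ ‖auxInner A η‖ * ‖(r ^ N * lact A (H N) : X →L[ℂ] X) ξ‖ := ContinuousLinearMap.le_opNorm _ _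
        _ ≤ _ := by
          gcongr
          exact ContinuousLinearMap.le_of_opNorm_le _ hrN ξ
    · have := (tendsto_pow_atTop_nhds_zero_of_lt_one (r := (1/8 : ℝ)) (by norm_num) (by norm_num))
      simpa using (this.mul_const ‖ξ‖).const_mul ‖auxInner A η‖
  rw [sub_zero] at hlim
  refine hI.mem_of_tendsto hlim (Eventually.of_forall fun N => ?_)
  rw [hfac N, aux_lact_pow_mul, ← map_sub, ← sub_apply, ← sub_mul]
  exact auxM_mul (aux_pow hr' N) _ ξ η

lemma aux_dist (a : A) {δ : ℝ} (hδ : 0 < δ) :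
    ‖a - a * cfc (auxG δ) (star a * a)‖ ^ 2 ≤ 4 * δ := by
  set h := star a * a with hh
  have hsa : IsSelfAdjoint h := IsSelfAdjoint.star_mul_self a
  have e1 : a - a * cfc (auxG δ) h = a * cfc (fun t : ℝ => 1 - auxG δ t) h := by
    rw [cfc_sub (fun _ : ℝ => (1:ℝ)) (auxG δ) h (by fun_prop) (auxG_cont δ).continuousOn,
      cfc_const_one ℝ h, mul_sub, mul_one]
  have hc : Continuous (fun t : ℝ => 1 - auxG δ t) := continuous_const.sub (auxG_cont δ)
  have hs : IsSelfAdjoint (cfc (fun t : ℝ => 1 - auxG δ t) h) := cfc_predicate _ h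
  have e2 : star (a * cfc (fun t : ℝ => 1 - auxG δ t) h) * (a * cfc (fun t : ℝ => 1 - auxG δ t) h)
      = cfc (fun t : ℝ => (1 - auxG δ t) * (t * (1 - auxG δ t))) h := by
    rw [cfc_mul (fun t : ℝ => 1 - auxG δ t) _ h hc.continuousOn (by fun_prop),
      cfc_mul (fun t : ℝ => t) _ h (by fun_prop) hc.continuousOn, cfc_id' ℝ h, star_mul,
      hs.star_eq, hh]
    noncomm_ring
  rw [e1, sq, ← CStarRing.norm_star_mul_self, e2]
  refine norm_cfc_le (by positivity) ?_
  intro t ht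
  have ht0 : 0 ≤ t := spectrum_star_mul_self_nonneg (b := a) t ht
  have h0 : 0 ≤ auxG δ t := le_min zero_le_one (le_max_left _ _)
  have h1 : auxG δ t ≤ 1 := min_le_left _ _
  rcases le_or_gt t (4 * δ) with h4 | h4
  · have hn : 0 ≤ 1 - auxG δ t := by linarith
    rw [Real.norm_of_nonneg (by positivity)]
    have : (1 - auxG δ t) * (t * (1 - auxG δ t)) ≤ 1 * (t * 1) := by
      gcongr <;> linarith
    linarith
  · have : auxG δ t = 1 := by
      unfold auxG
      have : 1 ≤ t / (2 * δ) - 1 := by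
        rw [le_sub_iff_add_le, le_div_iff₀ (by positivity)]; linarith
      exact min_eq_left (this.trans (le_max_right _ _))
    rw [this]; simp; positivity

end Aux8

open HilbertModule Correspondence in
/-- for an increasing family of closed ideals `Iₙ` of `A` with limit `I_∞`
and a closed ideal `J` with `φ_X(J) ⊂ K(X)`,
`J ∩ X⁻¹(I_∞) = lim (J ∩ X⁻¹(Iₙ))`. -/
theorem stmt8 {A : Type*} [CStarAlgebra A] {X : Type*} [NormedAddCommGroup X]
    [NormedSpace ℂ X] [Correspondence A X] [CompleteSpace X]
    (I : ℕ → TwoSidedIdeal A) (hmono : Monotone I)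
    (hclosed : ∀ n, IsClosed ((I n : Set A)))
    (J : TwoSidedIdeal A) (hJclosed : IsClosed ((J : Set A)))
    (hJ : ∀ a ∈ J, lact A (X := X) a ∈ compacts A X) :
    (J : Set A) ∩ corrInv X (closure (⋃ n, ((I n : Set A)))) =
      closure (⋃ n, ((J : Set A) ∩ corrInv X ((I n : Set A)))) := by
  have hinvmem : ∀ (K : TwoSidedIdeal A) (a : A),
      a ∈ corrInv X (K : Set A) ↔ lact A (X := X) a ∈ auxM X K := fun K a => Iff.rfl
  apply Set.Subset.antisymm
  · rintro a ⟨haJ, ha⟩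
    rw [Metric.mem_closure_iff]
    intro ε hε
    obtain ⟨δ, hδ, hδε⟩ : ∃ δ : ℝ, 0 < δ ∧ 4 * δ < ε ^ 2 :=
      ⟨ε ^ 2 / 8, by positivity, by nlinarith [sq_pos_of_pos hε]⟩
    set h := star a * a with hh
    have hhJ : h ∈ J := J.mul_mem_left _ _ haJ
    have hhinv : h ∈ corrInv X (closure (⋃ n, ((I n : Set A)))) := by
      intro ξ η
      have := inner_lsmul_left a η (lsmul a ξ)
      rw [← lsmul_mul] at this
      rw [hh, ← this]
      exact ha ξ _
    have hL : lact A (X := X) (h ^ 3) ∈ auxL X I := by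
      have e : h ^ 3 = h * (h * h) := by rw [pow_succ', pow_two]
      rw [e, aux_lact_mul h (h * h), aux_lact_mul h h]
      exact aux_sandwich I h hhinv (hJ h hhJ) (hJ h hhJ)
    obtain ⟨n, r, hr, hr'⟩ := aux_approx I hmono hL (ε := δ ^ 3) (by positivity)
    have hcut := aux_cut (I n) (hclosed n) h (IsSelfAdjoint.star_mul_self a) hδ hr hr'
    refine ⟨a * cfc (auxG δ) h, Set.mem_iUnion.2 ⟨n, J.mul_mem_right _ _ haJ, ?_⟩, ?_⟩
    · rw [hinvmem, aux_lact_mul]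
      exact auxM_lact_mul hcut a
    · rw [dist_eq_norm]
      exact lt_of_pow_lt_pow_left₀ 2 hε.le ((aux_dist a hδ).trans_lt hδε)
  · refine closure_minimal ?_ (hJclosed.inter ?_)
    · refine Set.iUnion_subset fun n a ha => ⟨ha.1, fun ξ η => ?_⟩
      exact subset_closure (Set.mem_iUnion.2 ⟨n, ha.2 ξ η⟩)
    · have : corrInv X (closure (⋃ n, ((I n : Set A)))) = ⋂ (ξ : X), ⋂ (η : X),
          (fun a : A => auxInner A η (lsmul a ξ)) ⁻¹' (closure (⋃ n, ((I n : Set A)))) := by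
        ext a; simp only [Set.mem_iInter]; exact Iff.rfl
      rw [this]
      refine isClosed_iInter fun ξ => isClosed_iInter fun η => isClosed_closure.preimage ?_
      refine (auxInner A η).continuous.comp ?_
      let f : A →ₗ[ℂ] X :=
        { toFun := fun a => lsmul a ξ
          map_add' := fun a b => lsmul_add_left a b ξ
          map_smul' := fun c a => lsmul_csmul_left c a ξ }
      exact (f.mkContinuous ‖ξ‖ (fun a => by
        rw [mul_comm]; exact norm_lsmul_le a ξ)).continuous
end
end
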